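/- For every non-bipartite d-regular graph G with d ≥ 3 that is an (s, δ)-vertex expander, the Res(⊕) space of the graph ordering principle satisfies Space(GOP(G)) ≥ δs/4 − d. -/

import Mathlib

open Finset

/-- The two-element field. -/
abbrev F2 : Type := ZMod 2

/-- An `F2`-linear form in the variables `V`, given by its coefficients. -/
abbrev LinForm (V : Type) : Type := V → F2

/-- A linear literal: an equation `f = a` where `f` is a linear form and `a ∈ F2`. -/
abbrev LinLit (V : Type) : Type := LinForm V × F2

/-- A linear clause: a finite disjunction of linear literals. -/
abbrev LinClause (V : Type) : Type := Finset (LinLit V)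

/-- A linear system: a finite conjunction of linear equations. -/
abbrev LinSystem (V : Type) : Type := Finset (LinLit V)

/-- A linear CNF formula: a conjunction of linear clauses. -/
abbrev LinCNF (V : Type) : Type := Set (LinClause V)

variable {V : Type}

/-- Evaluation of a linear form at an assignment. -/
def evalForm [Fintype V] (f : LinForm V) (σ : V → F2) : F2 := ∑ v, f v * σ v

/-- The assignment `σ` satisfies the linear equation `l.1 = l.2`. -/
def LitSat [Fintype V] (σ : V → F2) (l : LinLit V) : Prop := evalForm l.1 σ = l.2

/-- The assignment `σ` satisfies the linear clause `C` (some literal of `C` holds). -/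
def ClauseSat [Fintype V] (σ : V → F2) (C : LinClause V) : Prop := ∃ l ∈ C, LitSat σ l

/-- The assignment `σ` is a solution of the linear system `S` (all equations hold). -/
def SysSat [Fintype V] (σ : V → F2) (S : LinSystem V) : Prop := ∀ l ∈ S, LitSat σ l

/-- The assignment `σ` satisfies the linear CNF `φ`. -/
def CNFSat [Fintype V] (σ : V → F2) (φ : LinCNF V) : Prop := ∀ C ∈ φ, ClauseSat σ C

/-- The linear CNF `φ` is unsatisfiable. -/
def Unsat [Fintype V] (φ : LinCNF V) : Prop := ¬ ∃ σ, CNFSat σ φ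

/-- The positive literal `v = 1` for a single variable `v`. -/
def posLit [DecidableEq V] (v : V) : LinLit V := (Pi.single v 1, 1)

/-- The negative literal `v = 0` for a single variable `v`. -/
def negLit [DecidableEq V] (v : V) : LinLit V := (Pi.single v 1, 0)

/-- A solution is `F`-proper if it satisfies every clause of `F`. -/
def FProper [Fintype V] (F : Set (LinClause V)) (σ : V → F2) : Prop := ∀ C ∈ F, ClauseSat σ C

/-- `φ` is `m`-extensible w.r.t. `F`: every linear system with fewer than `m` equations
that has an `F`-proper solution has, for each clause `C ∈ φ \ F`, an `F`-proper solution
satisfying `C`. -/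
def Extensible [Fintype V] (φ : LinCNF V) (F : Set (LinClause V)) (m : ℕ) : Prop :=
  ∀ S : LinSystem V, S.card < m → (∃ σ, SysSat σ S ∧ FProper F σ) →
    ∀ C ∈ φ \ F, ∃ τ, SysSat τ S ∧ FProper F τ ∧ ClauseSat τ C

/-- A configuration: a finite set of linear clauses kept in memory. -/
abbrev Config (V : Type) : Type := Finset (LinClause V)

/-- Semantic inference: `C` follows from clauses in `S` by the resolution rule or the
semantic weakening rule. -/
def InferSem [Fintype V] [DecidableEq V] (S : Config V) (C : LinClause V) : Prop :=
  (∃ (f : LinForm V) (A B : LinClause V),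
      insert (f, (0 : F2)) A ∈ S ∧ insert (f, (1 : F2)) B ∈ S ∧ C = A ∪ B) ∨
  (∃ D ∈ S, ∀ σ, ClauseSat σ D → ClauseSat σ C)

/-- The identically zero linear form. -/
def zeroForm (V : Type) : LinForm V := fun _ => 0

/-- Syntactic inference: `C` follows from clauses in `S` by the resolution rule,
the simplification rule, the syntactic weakening rule, or the addition rule. -/
def InferSyn [Fintype V] [DecidableEq V] (S : Config V) (C : LinClause V) : Prop :=
  (∃ (f : LinForm V) (A B : LinClause V),
      insert (f, (0 : F2)) A ∈ S ∧ insert (f, (1 : F2)) B ∈ S ∧ C = A ∪ B) ∨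
  (insert ((zeroForm V, (1 : F2)) : LinLit V) C ∈ S) ∨
  (∃ (D : LinClause V) (f : LinForm V) (α : F2), D ∈ S ∧ C = insert (f, α) D) ∨
  (∃ (D : LinClause V) (f₁ f₂ : LinForm V) (α₁ α₂ : F2),
      insert (f₁, α₁) (insert (f₂, α₂) D) ∈ S ∧
      C = insert (f₁, α₁) (insert (f₁ + f₂, α₁ + α₂ + 1) D))

/-- One step of a configuration-style refutation: download a clause of `φ`,
erase a clause, or add a clause inferred (via `Inf`) from the current configuration. -/
inductive ConfigStep [Fintype V] [DecidableEq V] (φ : LinCNF V)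
    (Inf : Config V → LinClause V → Prop) : Config V → Config V → Prop
  | download {S : Config V} {C : LinClause V} (h : C ∈ φ) : ConfigStep φ Inf S (insert C S)
  | erase {S : Config V} {C : LinClause V} (h : C ∈ S) : ConfigStep φ Inf S (S.erase C)
  | infer {S : Config V} {C : LinClause V} (h : Inf S C) : ConfigStep φ Inf S (insert C S)

/-- A configuration-style Res(⊕) refutation of `φ` with inference rules `Inf`:
a sequence of configurations starting from the empty configuration, each obtained from
the previous one by a basic step, ending with a configuration containing the empty
clause. -/
def IsConfigRefutation [Fintype V] [DecidableEq V] (φ : LinCNF V)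
    (Inf : Config V → LinClause V → Prop) (π : List (Config V)) : Prop :=
  π.head? = some (∅ : Config V) ∧ List.Chain' (ConfigStep φ Inf) π ∧
    ∃ S : Config V, π.getLast? = some S ∧ (∅ : LinClause V) ∈ S

/-- The space of a sequence of configurations: the maximum number of clauses in memory. -/
def spaceOf (π : List (Config V)) : ℕ := (π.map Finset.card).foldr max 0

/-- The graph ordering principle `GOP(G)` as a linear CNF, in the variables `x_{uv}`:
antisymmetry, totality, transitivity, and the non-minimality clause
`NM_u = ⋁_{v ∈ N(u)} x_{vu}` for every vertex `u`. -/
def GOPCNF {W : Type} [Fintype W] [DecidableEq W] (G : SimpleGraph W)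
    [DecidableRel G.Adj] : LinCNF (W × W) :=
  {C | ∃ u v : W, u ≠ v ∧ C = ({negLit (u, v), negLit (v, u)} : LinClause (W × W))} ∪
  {C | ∃ u v : W, u ≠ v ∧ C = ({posLit (u, v), posLit (v, u)} : LinClause (W × W))} ∪
  {C | ∃ u v w : W, u ≠ v ∧ v ≠ w ∧ u ≠ w ∧
        C = ({negLit (u, v), negLit (v, w), posLit (u, w)} : LinClause (W × W))} ∪
  {C | ∃ u : W, C = (G.neighborFinset u).image fun v => posLit (v, u)}

/-- `G` is an `(s, δ)`-vertex expander: every vertex set of size at most `s` has outside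
neighborhood of size at least `δ` times its own size. -/
def IsVertexExpander {W : Type} [Fintype W] [DecidableEq W] (G : SimpleGraph W)
    [DecidableRel G.Adj] (s : ℕ) (δ : ℝ) : Prop :=
  ∀ U : Finset W, U.card ≤ s →
    δ * U.card ≤ ((Finset.univ.filter fun v => v ∉ U ∧ ∃ u ∈ U, G.Adj v u).card : ℝ)

section Reduction

open MvPolynomial

/-- The indicator polynomial of a linear literal. -/
noncomputable def litPoly [Fintype V] (l : LinLit V) : MvPolynomial V F2 :=
  ∑ v, C (l.1 v) * X v + C (l.2 + 1)

/-- The negation of a linear literal. -/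
def litNot (l : LinLit V) : LinLit V := (l.1, l.2 + 1)

lemma F2.eq_zero_or_one (a : F2) : a = 0 ∨ a = 1 := by
  revert a; decide

lemma F2.mul_self (a : F2) : a * a = a := by
  revert a; decide

lemma litPoly_litNot [Fintype V] (l : LinLit V) : litPoly (litNot l) = 1 + litPoly l := by
  simp only [litPoly, litNot, map_add, map_one]
  ring

lemma totalDegree_litPoly_le [Fintype V] (l : LinLit V) : (litPoly l).totalDegree ≤ 1 := by
  refine (totalDegree_add _ _).trans
    (max_le ?_ ((totalDegree_C (l.2 + 1)).trans_le zero_le_one))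
  refine totalDegree_finsetSum_le fun v _ => (totalDegree_mul _ _).trans ?_
  simp [totalDegree_X]

lemma totalDegree_prod_litPoly_le [Fintype V] {ι : Type*} (S : Finset ι) (f : ι → LinLit V) :
    (∏ i ∈ S, litPoly (f i)).totalDegree ≤ #S := by
  refine (totalDegree_finsetProd _ _).trans ?_
  simpa using Finset.sum_le_card_nsmul S _ 1 fun i _ => totalDegree_litPoly_le (f i)

lemma eval_litPoly [Fintype V] (σ : V → F2) (l : LinLit V) :
    eval σ (litPoly l) = evalForm l.1 σ + l.2 + 1 := by
  simp [litPoly, evalForm, add_assoc]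

lemma litSat_iff_eval_litPoly [Fintype V] (σ : V → F2) (l : LinLit V) :
    LitSat σ l ↔ eval σ (litPoly l) = 1 := by
  rw [eval_litPoly, LitSat]
  generalize evalForm l.1 σ = a
  generalize l.2 = b
  revert a b; decide

lemma litPoly_mul_self [Fintype V] (l : LinLit V) :
    litPoly l * litPoly l = ∑ v, C (l.1 v) * (X v * X v) + C (l.2 + 1) := by
  rw [litPoly, ← sq, CharTwo.add_sq, CharTwo.sum_sq, ← map_pow, sq, F2.mul_self]
  congr 1
  refine Finset.sum_congr rfl fun v _ => ?_
  rw [mul_pow, ← map_pow, sq, sq, F2.mul_self]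

/-- A linear operator on polynomials over `F2` that does not kill `1`, respects the Boolean
identities, and has a kernel closed under multiplication by variables below degree `D`. -/
structure IsDegreeReduction {T : Type*} [AddCommGroup T] [Module F2 T]
    (R : MvPolynomial V F2 →ₗ[F2] T) (D : ℕ) : Prop where
  one_ne_zero : R 1 ≠ 0
  boolean : ∀ v p, R (X v * (X v * p)) = R (X v * p)
  mul_eq_zero : ∀ v p, p.totalDegree < D → R p = 0 → R (X v * p) = 0

namespace IsDegreeReduction

variable {T : Type*} [AddCommGroup T] [Module F2 T] {R : MvPolynomial V F2 →ₗ[F2] T} {D : ℕ}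

lemma map_litPoly_mul [Fintype V] (R : MvPolynomial V F2 →ₗ[F2] T) (l : LinLit V)
    (p : MvPolynomial V F2) :
    R (litPoly l * p) = ∑ v, l.1 v • R (X v * p) + (l.2 + 1) • R p := by
  simp only [litPoly, add_mul, Finset.sum_mul, ← smul_eq_C_mul, smul_mul_assoc]
  rw [map_add, map_sum]
  simp only [map_smul]

lemma litPoly_idem [Fintype V] (hR : IsDegreeReduction R D) (l : LinLit V)
    (p : MvPolynomial V F2) : R (litPoly l * (litPoly l * p)) = R (litPoly l * p) := by
  rw [← mul_assoc, litPoly_mul_self, map_litPoly_mul]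
  simp only [add_mul, Finset.sum_mul, ← smul_eq_C_mul, smul_mul_assoc, mul_assoc]
  rw [map_add, map_sum]
  simp only [map_smul, hR.boolean]

lemma litPoly_mul_eq_zero [Fintype V] (hR : IsDegreeReduction R D) (l : LinLit V)
    {p : MvPolynomial V F2} (hp : p.totalDegree < D) (h : R p = 0) : R (litPoly l * p) = 0 := by
  simp [map_litPoly_mul, h, hR.mul_eq_zero _ p hp h]

lemma prod_litPoly_mul_eq_zero [Fintype V] (hR : IsDegreeReduction R D) {ι : Type*}
    (f : ι → LinLit V) (S : Finset ι) {p : MvPolynomial V F2}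
    (hp : p.totalDegree + #S ≤ D) (h : R p = 0) :
    R ((∏ i ∈ S, litPoly (f i)) * p) = 0 := by
  classical
  induction S using Finset.induction_on with
  | empty => simpa using h
  | insert a S ha ih =>
    rw [Finset.card_insert_of_notMem ha] at hp
    rw [Finset.prod_insert ha, mul_assoc]
    refine hR.litPoly_mul_eq_zero _ ?_ (ih (by omega))
    have h1 := totalDegree_mul (∏ i ∈ S, litPoly (f i)) p
    have h2 := totalDegree_prod_litPoly_le S f
    omega

/-- If `R` kills `p` times each literal of `C`, then multiplying `p` by the falsity of `C` does
not change its image under `R`. -/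
lemma prod_litNot_mul [Fintype V] (hR : IsDegreeReduction R D) (C : LinClause V)
    {p : MvPolynomial V F2} (hp : p.totalDegree + #C ≤ D)
    (h : ∀ c ∈ C, R (litPoly c * p) = 0) :
    R ((∏ c ∈ C, litPoly (litNot c)) * p) = R p := by
  classical
  induction C using Finset.induction_on with
  | empty => simp
  | insert a C ha ih =>
    rw [Finset.card_insert_of_notMem ha] at hp
    have ih' := ih (by omega) fun c hc => h c (Finset.mem_insert_of_mem hc)
    rw [Finset.prod_insert ha, litPoly_litNot, add_mul, one_mul, add_mul, map_add, ih',
      mul_right_comm, mul_comm (litPoly a * p),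
      hR.prod_litPoly_mul_eq_zero litNot C _ (h a (Finset.mem_insert_self a C)), add_zero]
    have h1 := totalDegree_mul (litPoly a) p
    have h2 := totalDegree_litPoly_le a
    omega

/-- The configuration `S` is consistent with `R`: some choice of one literal in each clause of
`S` has a conjunction that `R` does not kill. -/
def Consistent [Fintype V] (R : MvPolynomial V F2 →ₗ[F2] T) (S : Config V) : Prop :=
  ∃ ch : LinClause V → LinLit V, (∀ C ∈ S, ch C ∈ C) ∧ R (∏ C ∈ S, litPoly (ch C)) ≠ 0

lemma consistent_insert [Fintype V] [DecidableEq V] {S : Config V} {C : LinClause V}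
    {ch : LinClause V → LinLit V} (hch : ∀ C ∈ S, ch C ∈ C)
    (hS : R (∏ C ∈ S, litPoly (ch C)) ≠ 0)
    (hC : ∃ c ∈ C, R (litPoly c * ∏ C ∈ S, litPoly (ch C)) ≠ 0) :
    Consistent R (insert C S) := by
  classical
  by_cases hCS : C ∈ S
  · rw [Finset.insert_eq_of_mem hCS]
    exact ⟨ch, hch, hS⟩
  obtain ⟨c, hc, h⟩ := hC
  have hne : ∀ C' ∈ S, C' ≠ C := fun C' hC' h => hCS (h ▸ hC')
  refine ⟨Function.update ch C c, ?_, ?_⟩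
  · intro C' hC'
    rcases Finset.mem_insert.1 hC' with rfl | hC'
    · simpa using hc
    · rw [Function.update_of_ne (hne C' hC')]
      exact hch C' hC'
  · rw [Finset.prod_insert hCS, Function.update_self]
    rwa [Finset.prod_congr rfl fun C' hC' => by rw [Function.update_of_ne (hne C' hC')]]

lemma Consistent.erase [Fintype V] [DecidableEq V] (hR : IsDegreeReduction R D) {S : Config V}
    (hS : Consistent R S) (hD : #S ≤ D) {C : LinClause V} (hC : C ∈ S) :
    Consistent R (S.erase C) := by
  obtain ⟨ch, hch, h⟩ := hS
  refine ⟨ch, fun C' hC' => hch C' (Finset.mem_of_mem_erase hC'), fun h0 => h ?_⟩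
  rw [← Finset.mul_prod_erase S _ hC]
  refine hR.litPoly_mul_eq_zero _ ?_ h0
  have := totalDegree_prod_litPoly_le (S.erase C) ch
  have := Finset.card_erase_lt_of_mem hC
  omega

lemma Consistent.infer [Fintype V] [DecidableEq V] (hR : IsDegreeReduction R D) {S : Config V}
    (hS : Consistent R S) {C : LinClause V}
    (hC : ∀ σ, (∀ C' ∈ S, ClauseSat σ C') → ClauseSat σ C) :
    Consistent R (insert C S) := by
  obtain ⟨ch, hch, h⟩ := hS
  refine consistent_insert hch h ?_
  set q := ∏ C ∈ S, litPoly (ch C) with hq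
  obtain ⟨t, ht⟩ : ∃ t : Module.Dual F2 T, t (R q) ≠ 0 := by
    by_contra! h0
    exact h ((Module.forall_dual_apply_eq_zero_iff F2 _).1 h0)
  have ht1 : t (R q) = 1 := (F2.eq_zero_or_one _).resolve_left ht
  have key : ∀ l : LinLit V, eval (fun v => t (R (X v * q))) (litPoly l) =
      t (R (litPoly l * q)) := fun l => by
    rw [eval_litPoly, map_litPoly_mul]
    simp [evalForm, ht1, add_assoc]
  obtain ⟨c, hc, hsat⟩ := hC (fun v => t (R (X v * q))) fun C' hC' =>
    ⟨ch C', hch C' hC', by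
      rw [litSat_iff_eval_litPoly, key, hq, ← Finset.mul_prod_erase S _ hC', hR.litPoly_idem,
        Finset.mul_prod_erase S (fun C => litPoly (ch C)) hC', ← hq, ht1]⟩
  refine ⟨c, hc, fun h0 => ?_⟩
  rw [litSat_iff_eval_litPoly, key, h0, map_zero] at hsat
  exact zero_ne_one hsat

lemma Consistent.download [Fintype V] [DecidableEq V] (hR : IsDegreeReduction R D)
    {S : Config V} (hS : Consistent R S) {C : LinClause V} (hD : #S + #C ≤ D)
    (hC : R (∏ c ∈ C, litPoly (litNot c)) = 0) :
    Consistent R (insert C S) := by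
  obtain ⟨ch, hch, h⟩ := hS
  refine consistent_insert hch h ?_
  by_contra! h0
  refine h ?_
  have h1 := totalDegree_prod_litPoly_le S ch
  have h2 := totalDegree_prod_litPoly_le C litNot
  rw [← hR.prod_litNot_mul C (by omega) h0, mul_comm]
  exact hR.prod_litPoly_mul_eq_zero ch S (by omega) hC

lemma consistent_empty [Fintype V] (hR : IsDegreeReduction R D) :
    Consistent R (∅ : Config V) :=
  ⟨fun _ => (0, 0), by simp, by simpa using hR.one_ne_zero⟩

end IsDegreeReduction

lemma InferSem.sound [Fintype V] [DecidableEq V] {S : Config V} {C : LinClause V}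
    (h : InferSem S C) (σ : V → F2) (hσ : ∀ C' ∈ S, ClauseSat σ C') : ClauseSat σ C := by
  rcases h with ⟨f, A, B, hA, hB, rfl⟩ | ⟨D, hD, h⟩
  · obtain ⟨a, ha, hsa⟩ := hσ _ hA
    obtain ⟨b, hb, hsb⟩ := hσ _ hB
    rcases Finset.mem_insert.1 ha with rfl | ha
    · rcases Finset.mem_insert.1 hb with rfl | hb
      · simp only [LitSat] at hsa hsb
        exact absurd (hsa.symm.trans hsb) zero_ne_one
      · exact ⟨b, Finset.mem_union_right _ hb, hsb⟩
    · exact ⟨a, Finset.mem_union_left _ ha, hsa⟩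
  · exact h σ (hσ D hD)

lemma card_le_spaceOf {π : List (Config V)} {S : Config V} (h : S ∈ π) : #S ≤ spaceOf π := by
  induction π with
  | nil => simp at h
  | cons a π ih =>
    simp only [spaceOf, List.map_cons, List.foldr_cons] at ih ⊢
    rcases List.mem_cons.1 h with rfl | h
    · exact le_max_left _ _
    · exact (ih h).trans (le_max_right _ _)

lemma not_consistent_of_empty_mem {T : Type*} [AddCommGroup T] [Module F2 T]
    {R : MvPolynomial V F2 →ₗ[F2] T} [Fintype V] {S : Config V} (h : ∅ ∈ S) :
    ¬ IsDegreeReduction.Consistent R S := by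
  rintro ⟨ch, hch, -⟩
  simpa using hch ∅ h

/-- A degree reduction killing the falsity of every clause of `φ` bounds the space from below. -/
theorem lt_spaceOf_add_of_isDegreeReduction [Fintype V] [DecidableEq V] {T : Type*}
    [AddCommGroup T] [Module F2 T] {R : MvPolynomial V F2 →ₗ[F2] T} {D d : ℕ}
    (hR : IsDegreeReduction R D) {φ : LinCNF V} (hd : ∀ C ∈ φ, #C ≤ d)
    (hφ : ∀ C ∈ φ, R (∏ c ∈ C, litPoly (litNot c)) = 0)
    {π : List (Config V)} (hπ : IsConfigRefutation φ InferSem π) : D < spaceOf π + d := by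
  by_contra! hlt
  obtain ⟨h0, hchain, S, hlast, hS⟩ := hπ
  have hall : ∀ π' : List (Config V), (∀ S ∈ π', #S ≤ spaceOf π) →
      π'.IsChain (ConfigStep φ InferSem) →
      (∀ S, π'.head? = some S → IsDegreeReduction.Consistent R S) →
      ∀ S ∈ π', IsDegreeReduction.Consistent R S := by
    intro π'
    induction π' with
    | nil => simp
    | cons a π' ih =>
      intro hsp hch hhead S hS
      have ha := hhead a rfl
      have hcard := hsp a (by simp)
      rcases List.mem_cons.1 hS with rfl | hS
      · exact ha
      refine ih (fun S hS => hsp S (by simp [hS])) hch.tail (fun b hb => ?_) S hS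
      obtain ⟨π'', rfl⟩ : ∃ π'', π' = b :: π'' := by
        cases π' with
        | nil => simp at hb
        | cons c l => exact ⟨l, by simpa using hb⟩
      rw [List.isChain_cons_cons] at hch
      cases hch.1 with
      | download h => exact ha.download hR (by have := hd _ h; omega) (hφ _ h)
      | erase h => exact ha.erase hR (by omega) h
      | infer h => exact ha.infer hR h.sound
  refine not_consistent_of_empty_mem hS (hall π (fun S => card_le_spaceOf) hchain ?_ S
    (List.mem_of_getLast? hlast))
  rintro S hS
  rw [h0] at hS
  obtain rfl := Option.some.inj hS
  exact hR.consistent_empty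

end Reduction

section NormalForm

variable {β : Type*}

/-- `b` is reducible modulo `I` to a combination of elements of smaller rank. -/
def Reducible (rk : β → ℕ) (I : Submodule F2 (β →₀ F2)) (b : β) : Prop :=
  ∃ q ∈ Finsupp.supported F2 F2 {c | rk c < rk b}, Finsupp.single b 1 - q ∈ I

lemma single_eq_one_of_mem_support {q : β →₀ F2} {b : β} (hb : b ∈ q.support) : q b = 1 :=
  (F2.eq_zero_or_one _).resolve_left (Finsupp.mem_support_iff.1 hb)

/-- An element of `I` has reducible leading term. -/
lemma reducible_of_mem {rk : β → ℕ} {I : Submodule F2 (β →₀ F2)} {q : β →₀ F2} (hq : q ∈ I)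
    {b : β} (hb : q b = 1) (hlt : ∀ c, c ≠ b → q c ≠ 0 → rk c < rk b) : Reducible rk I b := by
  classical
  refine ⟨Finsupp.single b 1 - q, ?_, by simpa using hq⟩
  rw [Finsupp.mem_supported]
  intro c hc
  rw [Finset.mem_coe, Finsupp.mem_support_iff, Finsupp.sub_apply] at hc
  by_cases hcb : c = b
  · subst hcb
    simp [hb] at hc
  · exact hlt c hcb fun h0 => hc (by simp [h0, Finsupp.single_eq_of_ne hcb])

lemma exists_irreducible_single (rk : β → ℕ) (I : Submodule F2 (β →₀ F2)) (b : β) :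
    ∃ q ∈ Finsupp.supported F2 F2 {c | ¬ Reducible rk I c ∧ rk c ≤ rk b},
      Finsupp.single b 1 - q ∈ I := by
  induction hn : rk b using Nat.strong_induction_on generalizing b with
  | _ n ih =>
  subst hn
  by_cases hb : Reducible rk I b
  · obtain ⟨q, hq, hI⟩ := hb
    have hle : Finsupp.supported F2 F2 {c | rk c < rk b} ≤
        Finsupp.supported F2 F2 {c | ¬ Reducible rk I c ∧ rk c ≤ rk b} ⊔ I := by
      rw [Finsupp.supported_eq_span_single, Submodule.span_le]
      rintro _ ⟨c, hc, rfl⟩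
      obtain ⟨r, hr, hrI⟩ := ih (rk c) hc c rfl
      refine Submodule.mem_sup.2 ⟨r, Finsupp.supported_mono (fun e he => ?_) hr, _, hrI, by abel⟩
      exact ⟨he.1, he.2.trans (le_of_lt hc)⟩
    obtain ⟨r, hr, i, hi, hri⟩ := Submodule.mem_sup.1 (hle hq)
    refine ⟨r, hr, ?_⟩
    have := I.add_mem hI hi
    rwa [← hri, sub_add_eq_sub_sub, sub_add_cancel] at this
  · exact ⟨Finsupp.single b 1, Finsupp.single_mem_supported F2 _ ⟨hb, le_rfl⟩, by simp⟩

lemma eq_zero_of_mem_of_irreducible {rk : β → ℕ} (hrk : Function.Injective rk)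
    {I : Submodule F2 (β →₀ F2)} {q : β →₀ F2}
    (hq : q ∈ Finsupp.supported F2 F2 {c | ¬ Reducible rk I c}) (hI : q ∈ I) : q = 0 := by
  by_contra h0
  obtain ⟨b, hb, hmax⟩ := q.support.exists_max_image rk (Finsupp.support_nonempty_iff.2 h0)
  refine (Finsupp.mem_supported F2 q).1 hq (Finset.mem_coe.2 hb)
    (reducible_of_mem hI (single_eq_one_of_mem_support hb) fun c hcb hc => ?_)
  exact lt_of_le_of_ne (hmax c (Finsupp.mem_support_iff.2 hc)) fun h => hcb (hrk h)

/-- The normal form modulo `I`: the representative supported on irreducible elements. -/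
noncomputable def normalForm (rk : β → ℕ) (I : Submodule F2 (β →₀ F2)) :
    (β →₀ F2) →ₗ[F2] (β →₀ F2) :=
  Finsupp.linearCombination F2 fun b => (exists_irreducible_single rk I b).choose

lemma normalForm_single_mem (rk : β → ℕ) (I : Submodule F2 (β →₀ F2)) (b : β) :
    normalForm rk I (Finsupp.single b 1) ∈
      Finsupp.supported F2 F2 {c | ¬ Reducible rk I c ∧ rk c ≤ rk b} := by
  simpa [normalForm] using (exists_irreducible_single rk I b).choose_spec.1

lemma finsupp_induction_single {P : Submodule F2 (β →₀ F2)}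
    (h : ∀ b, Finsupp.single b 1 ∈ P) (p : β →₀ F2) : p ∈ P := by
  rw [← Finsupp.sum_single p]
  refine P.sum_mem fun b _ => ?_
  rw [← mul_one (p b), ← smul_eq_mul, ← Finsupp.smul_single]
  exact P.smul_mem _ (h b)

lemma normalForm_mem (rk : β → ℕ) (I : Submodule F2 (β →₀ F2)) (p : β →₀ F2) :
    normalForm rk I p ∈ Finsupp.supported F2 F2 {c | ¬ Reducible rk I c} :=
  finsupp_induction_single
    (P := (Finsupp.supported F2 F2 {c | ¬ Reducible rk I c}).comap (normalForm rk I))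
    (fun b => Finsupp.supported_mono (fun _ h => h.1) (normalForm_single_mem rk I b)) p

lemma sub_normalForm_mem (rk : β → ℕ) (I : Submodule F2 (β →₀ F2)) (p : β →₀ F2) :
    p - normalForm rk I p ∈ I := by
  have h : p ∈ I.comap (LinearMap.id - normalForm rk I) :=
    finsupp_induction_single (fun b => by
      simpa [normalForm] using (exists_irreducible_single rk I b).choose_spec.2) p
  simpa only [Submodule.mem_comap, LinearMap.sub_apply, LinearMap.id_apply] using h

lemma normalForm_eq_of {rk : β → ℕ} (hrk : Function.Injective rk)
    {I : Submodule F2 (β →₀ F2)} {p q : β →₀ F2}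
    (hq : q ∈ Finsupp.supported F2 F2 {c | ¬ Reducible rk I c}) (h : p - q ∈ I) :
    normalForm rk I p = q := by
  refine sub_eq_zero.1 (eq_zero_of_mem_of_irreducible hrk
    (Submodule.sub_mem _ (normalForm_mem rk I p) hq) ?_)
  have := I.sub_mem h (sub_normalForm_mem rk I p)
  rwa [sub_sub_sub_cancel_left] at this

lemma normalForm_eq_zero_iff {rk : β → ℕ} (hrk : Function.Injective rk)
    {I : Submodule F2 (β →₀ F2)} {p : β →₀ F2} : normalForm rk I p = 0 ↔ p ∈ I := by
  refine ⟨fun h => ?_, fun h => normalForm_eq_of hrk (Submodule.zero_mem _) (by simpa using h)⟩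
  simpa [h] using sub_normalForm_mem rk I p

end NormalForm

section Orderings

variable {W : Type}

/-- A rank of finite sets that is injective and refines the order by cardinality. -/
noncomputable def cardRank {α : Type*} [Fintype α] (A : Finset α) : ℕ :=
  Fintype.equivFin (Finset α) A + Fintype.card (Finset α) * #A

lemma cardRank_injective {α : Type*} [Fintype α] :
    Function.Injective (cardRank : Finset α → ℕ) := by
  intro A B h
  have h' := congrArg (· % Fintype.card (Finset α)) h
  simp only [cardRank, Nat.add_mul_mod_self_left, Nat.mod_eq_of_lt (Fin.is_lt _)] at h'
  exact (Fintype.equivFin (Finset α)).injective (Fin.ext h')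

lemma cardRank_lt_cardRank {α : Type*} [Fintype α] {A B : Finset α} (h : #A < #B) :
    cardRank A < cardRank B := by
  have h1 := (Fintype.equivFin (Finset α) A).is_lt
  have h2 := Nat.mul_le_mul_left (Fintype.card (Finset α)) (Nat.succ_le_of_lt h)
  rw [Nat.mul_succ] at h2
  simp only [cardRank]
  omega

lemma cardRank_le_of_subset {α : Type*} [Fintype α] {A B : Finset α} (h : A ⊆ B) :
    cardRank A ≤ cardRank B := by
  rcases h.eq_or_ssubset with rfl | h
  · exact le_rfl
  · exact (cardRank_lt_cardRank (Finset.card_lt_card h)).le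

lemma card_le_of_cardRank_le {α : Type*} [Fintype α] {A B : Finset α}
    (h : cardRank A ≤ cardRank B) : #A ≤ #B :=
  not_lt.1 fun h' => h.not_gt (cardRank_lt_cardRank h')

/-- The value of the multilinear monomial `∏ x_{uv}` over `(u, v) ∈ A` in the ordering with rank
function `h`. -/
def monomialValue (A : Finset (W × W)) (h : W → ℕ) : F2 :=
  ∏ p ∈ A, if h p.1 < h p.2 then 1 else 0

/-- Evaluation of multilinear polynomials at the ordering with rank function `h`. -/
noncomputable def ordEval (h : W → ℕ) : (Finset (W × W) →₀ F2) →ₗ[F2] F2 :=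
  Finsupp.linearCombination F2 fun A => monomialValue A h

/-- The orderings in which no element of `X` is minimal in its neighborhood. -/
def goodOrders (G : SimpleGraph W) (X : Finset W) : Set (W → ℕ) :=
  {h | Function.Injective h ∧ ∀ x ∈ X, ∃ v, G.Adj v x ∧ h v < h x}

/-- The multilinear polynomials vanishing on `goodOrders G X`. -/
noncomputable def vanishing (G : SimpleGraph W) (X : Finset W) :
    Submodule F2 (Finset (W × W) →₀ F2) :=
  ⨅ h ∈ goodOrders G X, LinearMap.ker (ordEval h)

lemma mem_vanishing {G : SimpleGraph W} {X : Finset W} {p : Finset (W × W) →₀ F2} :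
    p ∈ vanishing G X ↔ ∀ h ∈ goodOrders G X, ordEval h p = 0 := by
  simp [vanishing, Submodule.mem_iInf]

lemma vanishing_mono {G : SimpleGraph W} {X Y : Finset W} (h : X ⊆ Y) :
    vanishing G X ≤ vanishing G Y := fun _ hp =>
  mem_vanishing.2 fun f hf => mem_vanishing.1 hp f ⟨hf.1, fun x hx => hf.2 x (h hx)⟩

variable [DecidableEq W]

/-- The vertices occurring in a set of pairs. -/
def vertices (A : Finset (W × W)) : Finset W := A.image Prod.fst ∪ A.image Prod.snd

lemma vertices_subset_iff {A : Finset (W × W)} {S : Finset W} :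
    vertices A ⊆ S ↔ ∀ p ∈ A, p.1 ∈ S ∧ p.2 ∈ S := by
  simp only [vertices, Finset.union_subset_iff, Finset.image_subset_iff]
  exact ⟨fun h p hp => ⟨h.1 p hp, h.2 p hp⟩, fun h => ⟨fun p hp => (h p hp).1,
    fun p hp => (h p hp).2⟩⟩

lemma vertices_mono {A B : Finset (W × W)} (h : A ⊆ B) : vertices A ⊆ vertices B :=
  Finset.union_subset_union (Finset.image_subset_image h) (Finset.image_subset_image h)

lemma card_vertices_le (A : Finset (W × W)) : #(vertices A) ≤ 2 * #A := by
  have h1 := Finset.card_union_le (A.image Prod.fst) (A.image Prod.snd)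
  have h2 := Finset.card_image_le (s := A) (f := Prod.fst)
  have h3 := Finset.card_image_le (s := A) (f := Prod.snd)
  simp only [vertices]
  omega

/-- The pairs of `A` with both entries in `S`. -/
def inside (S : Finset W) (A : Finset (W × W)) : Finset (W × W) :=
  A.filter fun p => p.1 ∈ S ∧ p.2 ∈ S

lemma vertices_inside (S : Finset W) (A : Finset (W × W)) : vertices (inside S A) ⊆ S :=
  vertices_subset_iff.2 fun _ hp => (Finset.mem_filter.1 hp).2

lemma inside_eq_self {S : Finset W} {A : Finset (W × W)} (h : vertices A ⊆ S) :
    inside S A = A :=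
  Finset.filter_true_of_mem (vertices_subset_iff.1 h)

/-- The rank function `h` on `S`, placed above the rank function `g` outside of `S`. -/
def placeAbove (S : Finset W) (g : W → ℕ) (n : ℕ) (h : W → ℕ) (w : W) : ℕ :=
  if w ∈ S then h w + n else g w

lemma monomialValue_placeAbove (S : Finset W) {g : W → ℕ} {n : ℕ} (hg : ∀ w, g w < n)
    (h : W → ℕ) (A : Finset (W × W)) :
    monomialValue A (placeAbove S g n h) =
      monomialValue (A \ inside S A) (placeAbove S g n 0) * monomialValue (inside S A) h := by
  simp only [monomialValue]
  rw [← Finset.prod_sdiff (Finset.filter_subset _ A : inside S A ⊆ A)]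
  congr 1
  · refine Finset.prod_congr rfl fun p hp => ?_
    have h1 := hg p.1
    have h2 := hg p.2
    simp only [inside, Finset.mem_sdiff, Finset.mem_filter, not_and] at hp
    by_cases hp1 : p.1 ∈ S <;> by_cases hp2 : p.2 ∈ S
    · exact absurd hp2 (hp.2 hp.1 hp1)
    · refine if_congr ?_ rfl rfl
      simp only [placeAbove, hp1, hp2, if_true, if_false, Pi.zero_apply]
      omega
    · refine if_congr ?_ rfl rfl
      simp only [placeAbove, hp1, hp2, if_true, if_false, Pi.zero_apply]
      omega
    · simp only [placeAbove, hp1, hp2, if_false]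
  · refine Finset.prod_congr rfl fun p hp => ?_
    obtain ⟨-, hp1, hp2⟩ := Finset.mem_filter.1 hp
    simp [placeAbove, hp1, hp2]

/-- The substitution of an ordering outside of `S` into multilinear polynomials. -/
noncomputable def restrictBelow (S : Finset W) (g : W → ℕ) (n : ℕ) :
    (Finset (W × W) →₀ F2) →ₗ[F2] (Finset (W × W) →₀ F2) :=
  Finsupp.linearCombination F2 fun A =>
    Finsupp.single (inside S A) (monomialValue (A \ inside S A) (placeAbove S g n 0))

lemma restrictBelow_single (S : Finset W) (g : W → ℕ) (n : ℕ) (A : Finset (W × W)) :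
    restrictBelow S g n (Finsupp.single A 1) =
      Finsupp.single (inside S A) (monomialValue (A \ inside S A) (placeAbove S g n 0)) := by
  simp [restrictBelow]

lemma restrictBelow_single_eq_self {S : Finset W} (g : W → ℕ) (n : ℕ) {A : Finset (W × W)}
    (h : vertices A ⊆ S) :
    restrictBelow S g n (Finsupp.single A 1) = Finsupp.single A 1 := by
  simp [restrictBelow_single, inside_eq_self h, monomialValue]

lemma ordEval_restrictBelow (S : Finset W) {g : W → ℕ} {n : ℕ} (hg : ∀ w, g w < n)
    (h : W → ℕ) (p : Finset (W × W) →₀ F2) :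
    ordEval h (restrictBelow S g n p) = ordEval (placeAbove S g n h) p := by
  have : (ordEval h).comp (restrictBelow S g n) = ordEval (placeAbove S g n h) := by
    refine Finsupp.lhom_ext' fun A => LinearMap.ext_ring ?_
    simp only [LinearMap.comp_apply, Finsupp.lsingle_apply, restrictBelow_single, ordEval,
      Finsupp.linearCombination_single, smul_eq_mul, one_mul, monomialValue_placeAbove S hg h A]
  exact LinearMap.congr_fun this p

lemma restrictBelow_mem_vanishing {G : SimpleGraph W} {S X Y : Finset W} {g : W → ℕ} {n : ℕ}
    (hg : ∀ w, g w < n) (hXY : ∀ h ∈ goodOrders G X, placeAbove S g n h ∈ goodOrders G Y)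
    {p : Finset (W × W) →₀ F2} (hp : p ∈ vanishing G Y) :
    restrictBelow S g n p ∈ vanishing G X :=
  mem_vanishing.2 fun h hh => by
    rw [ordEval_restrictBelow S hg]
    exact mem_vanishing.1 hp _ (hXY h hh)

lemma restrictBelow_mem_supported {S : Finset W} {g : W → ℕ} {n : ℕ}
    {P : Finset (W × W) → Prop} (hP : ∀ A, P A → P (inside S A))
    {p : Finset (W × W) →₀ F2} (hp : p ∈ Finsupp.supported F2 F2 {A | P A}) :
    restrictBelow S g n p ∈ Finsupp.supported F2 F2 {A | P A} := by
  have hle : Finsupp.supported F2 F2 {A | P A} ≤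
      (Finsupp.supported F2 F2 {A | P A}).comap (restrictBelow S g n) := by
    conv_lhs => rw [Finsupp.supported_eq_span_single]
    rw [Submodule.span_le]
    rintro _ ⟨A, hA, rfl⟩
    simp only [SetLike.mem_coe, Submodule.mem_comap, restrictBelow_single]
    exact Finsupp.single_mem_supported F2 _ (hP A hA)
  exact hle hp

variable [Fintype W]

/-- Normal forms of monomials in `S` only mention vertices in `S`, provided every good ordering
of `X` can be placed above a fixed ordering outside of `S`. -/
lemma normalForm_mem_supported_vertices {G : SimpleGraph W} {S X : Finset W} {g : W → ℕ} {n : ℕ}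
    (hg : ∀ w, g w < n) (hX : ∀ h ∈ goodOrders G X, placeAbove S g n h ∈ goodOrders G X)
    {A : Finset (W × W)} (hA : vertices A ⊆ S) :
    normalForm cardRank (vanishing G X) (Finsupp.single A 1) ∈
      Finsupp.supported F2 F2 {B | vertices B ⊆ S} := by
  set q := normalForm cardRank (vanishing G X) (Finsupp.single A 1) with hq
  have hAq : Finsupp.single A 1 - q ∈ vanishing G X := sub_normalForm_mem _ _ _
  have hqq : q - restrictBelow S g n q ∈ vanishing G X := by
    have h := restrictBelow_mem_vanishing hg hX hAq
    rw [map_sub, restrictBelow_single_eq_self g n hA] at h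
    have := Submodule.sub_mem _ h hAq
    rwa [sub_sub_sub_cancel_left] at this
  by_contra hnot
  have hne : (q.support.filter fun B => ¬ vertices B ⊆ S).Nonempty := by
    by_contra he
    rw [Finset.not_nonempty_iff_eq_empty, Finset.filter_eq_empty_iff] at he
    exact hnot ((Finsupp.mem_supported F2 q).2 fun B hB => not_not.1 (he hB))
  obtain ⟨B, hB, hmax⟩ := Finset.exists_max_image _ cardRank hne
  rw [Finset.mem_filter] at hB
  have hBir := (Finsupp.mem_supported F2 q).1
    (normalForm_mem cardRank (vanishing G X) (Finsupp.single A 1)) hB.1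
  refine hBir (reducible_of_mem hqq ?_ ?_)
  · have h0 : restrictBelow S g n q ∈ Finsupp.supported F2 F2 {C | vertices C ⊆ S} := by
      rw [← Finsupp.sum_single q, map_finsuppSum]
      refine Submodule.sum_mem _ fun C _ => ?_
      dsimp only
      rw [← mul_one (q C), ← smul_eq_mul, ← Finsupp.smul_single, map_smul, restrictBelow_single]
      exact Submodule.smul_mem _ _ (Finsupp.single_mem_supported F2 _ (vertices_inside S C))
    have h1 : restrictBelow S g n q B = 0 := by
      by_contra h1
      exact hB.2 ((Finsupp.mem_supported F2 _).1 h0 (Finsupp.mem_support_iff.2 h1))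
    rw [Finsupp.sub_apply, h1, sub_zero, single_eq_one_of_mem_support hB.1]
  · intro C hCB hC
    have hmem : q - restrictBelow S g n q ∈
        Finsupp.supported F2 F2 {C | cardRank C ≤ cardRank B} := by
      have hsum : q - restrictBelow S g n q =
          ∑ C ∈ q.support,
            q C • (Finsupp.single C 1 - restrictBelow S g n (Finsupp.single C 1)) := by
        conv_lhs => rw [← Finsupp.sum_single q]
        rw [map_finsuppSum, Finsupp.sum, Finsupp.sum, ← Finset.sum_sub_distrib]
        refine Finset.sum_congr rfl fun C _ => ?_
        rw [smul_sub, ← map_smul, Finsupp.smul_single, smul_eq_mul, mul_one]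
      rw [hsum]
      refine Submodule.sum_mem _ fun C hCq => Submodule.smul_mem _ _ ?_
      by_cases hCS : vertices C ⊆ S
      · rw [restrictBelow_single_eq_self g n hCS, sub_self]
        exact Submodule.zero_mem _
      · have hCB := hmax C (Finset.mem_filter.2 ⟨hCq, hCS⟩)
        rw [restrictBelow_single]
        exact Submodule.sub_mem _ (Finsupp.single_mem_supported F2 _ hCB)
          (Finsupp.single_mem_supported F2 _
            ((cardRank_le_of_subset (Finset.filter_subset _ C)).trans hCB))
    exact lt_of_le_of_ne ((Finsupp.mem_supported F2 _).1 hmem (Finsupp.mem_support_iff.2 hC))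
      fun h => hCB (cardRank_injective h)

lemma Reducible.of_placeAbove {G : SimpleGraph W} {S X Y : Finset W} {g : W → ℕ} {n : ℕ}
    (hg : ∀ w, g w < n) (hXY : ∀ h ∈ goodOrders G X, placeAbove S g n h ∈ goodOrders G Y)
    {B : Finset (W × W)} (hB : vertices B ⊆ S) (h : Reducible cardRank (vanishing G Y) B) :
    Reducible cardRank (vanishing G X) B := by
  obtain ⟨q, hq, hI⟩ := h
  refine ⟨restrictBelow S g n q, restrictBelow_mem_supported (fun A hA => ?_) hq, ?_⟩
  · exact (cardRank_le_of_subset (Finset.filter_subset _ A)).trans_lt hA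
  · simpa [restrictBelow_single_eq_self g n hB] using restrictBelow_mem_vanishing hg hXY hI

end Orderings

section Expander

variable {W : Type} [Fintype W] [DecidableEq W] (G : SimpleGraph W) [DecidableRel G.Adj]

/-- The outer vertex boundary of `X`. -/
def outerNbrs (X : Finset W) : Finset W :=
  Finset.univ.filter fun v => v ∉ X ∧ ∃ u ∈ X, G.Adj v u

variable {G} in
lemma mem_outerNbrs {X : Finset W} {v : W} :
    v ∈ outerNbrs G X ↔ v ∉ X ∧ ∃ u ∈ X, G.Adj v u := by
  simp [outerNbrs]

lemma outerNbrs_union_subset (X Y : Finset W) :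
    outerNbrs G (X ∪ Y) ⊆ outerNbrs G X ∪ outerNbrs G Y := by
  intro v hv
  simp only [Finset.mem_union, mem_outerNbrs, not_or] at hv ⊢
  obtain ⟨⟨hX, hY⟩, u, hu | hu, ha⟩ := hv
  · exact Or.inl ⟨hX, u, hu, ha⟩
  · exact Or.inr ⟨hY, u, hu, ha⟩

/-- The union of all sets of at most `s` vertices whose outer boundary lies in `P`. -/
def boundaryClosure (s : ℕ) (P : Finset W) : Finset W :=
  (Finset.univ.filter fun X => #X ≤ s ∧ outerNbrs G X ⊆ P).sup id

variable {G} {s : ℕ} {δ : ℝ}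

lemma subset_boundaryClosure {P X : Finset W} (hX : #X ≤ s) (hP : outerNbrs G X ⊆ P) :
    X ⊆ boundaryClosure G s P :=
  Finset.le_sup (f := id) (Finset.mem_filter.2 ⟨Finset.mem_univ X, hX, hP⟩)

lemma boundaryClosure_mono {P Q : Finset W} (h : P ⊆ Q) :
    boundaryClosure G s P ⊆ boundaryClosure G s Q :=
  Finset.sup_mono fun X hX => by
    rw [Finset.mem_filter] at hX ⊢
    exact ⟨hX.1, hX.2.1, hX.2.2.trans h⟩

lemma IsVertexExpander.two_mul_card_lt (hexp : IsVertexExpander G s δ) {P X : Finset W}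
    (hs : 2 * (#P : ℝ) < δ * s) (hX : #X ≤ s) (hP : outerNbrs G X ⊆ P) : 2 * #X < s := by
  have h1 : δ * #X ≤ #P := (hexp X hX).trans (by exact_mod_cast Finset.card_le_card hP)
  have hδs : 0 < δ * s := lt_of_le_of_lt (by positivity) hs
  have hδ : 0 < δ := pos_of_mul_pos_left hδs (Nat.cast_nonneg s)
  have h2 : δ * (2 * #X) < δ * s := by linarith
  exact_mod_cast lt_of_mul_lt_mul_left h2 hδ.le

lemma IsVertexExpander.boundaryClosure_spec (hexp : IsVertexExpander G s δ) {P : Finset W}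
    (hs : 2 * (#P : ℝ) < δ * s) :
    #(boundaryClosure G s P) ≤ s ∧ outerNbrs G (boundaryClosure G s P) ⊆ P := by
  refine Finset.sup_induction (p := fun X => #X ≤ s ∧ outerNbrs G X ⊆ P) ?_ ?_ ?_
  · simp [outerNbrs]
  · intro X hX Y hY
    have h1 := hexp.two_mul_card_lt hs hX.1 hX.2
    have h2 := hexp.two_mul_card_lt hs hY.1 hY.2
    have h3 := Finset.card_union_le X Y
    exact ⟨by rw [Finset.sup_eq_union]; omega,
      (outerNbrs_union_subset G X Y).trans (Finset.union_subset hX.2 hY.2)⟩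
  · intro X hX
    exact (Finset.mem_filter.1 hX).2

lemma IsVertexExpander.two_mul_card_boundaryClosure_lt (hexp : IsVertexExpander G s δ)
    {P : Finset W} (hs : 2 * (#P : ℝ) < δ * s) : 2 * #(boundaryClosure G s P) < s :=
  hexp.two_mul_card_lt hs (hexp.boundaryClosure_spec hs).1 (hexp.boundaryClosure_spec hs).2

omit [Fintype W] [DecidableRel G.Adj] in
/-- If every nonempty subset of `Q` has a neighbor outside of itself and of `S`, the vertices can
be leveled so that each vertex of `Q` has a neighbor outside of `S` on a smaller level. -/
lemma exists_level {S Q : Finset W}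
    (h : ∀ U ⊆ Q, U.Nonempty → ∃ u ∈ U, ∃ v, v ∉ S ∧ v ∉ U ∧ G.Adj v u) :
    ∃ lev : W → ℕ, ∀ q ∈ Q, ∃ v, v ∉ S ∧ G.Adj v q ∧ lev v < lev q := by
  suffices ∃ lev : W → ℕ, (∀ w ∉ Q, lev w = 0) ∧
      ∀ q ∈ Q, ∃ v, v ∉ S ∧ G.Adj v q ∧ lev v < lev q from
    this.imp fun _ h => h.2
  induction Q using Finset.strongInduction with
  | H Q ih =>
  rcases Q.eq_empty_or_nonempty with rfl | hne
  · exact ⟨0, by simp, by simp⟩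
  obtain ⟨u, hu, v, hvS, hvQ, huv⟩ := h Q subset_rfl hne
  obtain ⟨lev, -, hlev⟩ := ih (Q.erase u) (Finset.erase_ssubset hu) fun U hU =>
    h U (hU.trans (Finset.erase_subset u Q))
  refine ⟨fun w => if w ∈ Q then lev w + 1 else 0, fun w hw => by simp [hw], fun q hq => ?_⟩
  by_cases hqu : q = u
  · subst hqu
    exact ⟨v, hvS, huv, by simp [hvQ, hq]⟩
  · obtain ⟨w, hwS, hwq, hlt⟩ := hlev q (Finset.mem_erase.2 ⟨hqu, hq⟩)
    refine ⟨w, hwS, hwq, ?_⟩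
    simp only [hq, if_true]
    split_ifs <;> omega

omit [DecidableEq W] in
lemma exists_injective_refinement (lev : W → ℕ) :
    ∃ g : W → ℕ, Function.Injective g ∧ (∀ v w, lev v < lev w → g v < g w) ∧
      ∃ n, ∀ w, g w < n := by
  classical
  have hidx : ∀ w, (Fintype.equivFin W w : ℕ) < Fintype.card W := fun w => Fin.is_lt _
  refine ⟨fun w => Fintype.equivFin W w + Fintype.card W * lev w, fun v w h => ?_,
    fun v w h => ?_, ?_⟩
  · have h' := congrArg (· % Fintype.card W) h
    simp only [Nat.add_mul_mod_self_left, Nat.mod_eq_of_lt (hidx _)] at h'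
    exact (Fintype.equivFin W).injective (Fin.ext h')
  · have h1 := hidx v
    have h2 := Nat.mul_le_mul_left (Fintype.card W) (Nat.succ_le_of_lt h)
    rw [Nat.mul_succ] at h2
    dsimp only
    omega
  · obtain ⟨n, hn⟩ := (Set.finite_range fun w =>
      (Fintype.equivFin W w + Fintype.card W * lev w : ℕ)).bddAbove
    exact ⟨n + 1, fun w => Nat.lt_succ_of_le (hn ⟨w, rfl⟩)⟩

/-- Orderings good for the boundary closure of `P` can be placed above a fixed ordering so as to
become good for a given set of at most `s` vertices. -/
lemma IsVertexExpander.exists_placeAbove (hexp : IsVertexExpander G s δ) {P Y : Finset W}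
    (hs : 2 * (#P : ℝ) < δ * s) (hY : #Y ≤ s) :
    ∃ (g : W → ℕ) (n : ℕ), (∀ w, g w < n) ∧ ∀ h ∈ goodOrders G (boundaryClosure G s P),
      placeAbove (P ∪ boundaryClosure G s P) g n h ∈ goodOrders G Y := by
  have hXs := hexp.two_mul_card_boundaryClosure_lt hs
  obtain ⟨-, hXP⟩ := hexp.boundaryClosure_spec hs
  have hmax : ∀ Z : Finset W, #Z ≤ s → outerNbrs G Z ⊆ P → Z ⊆ boundaryClosure G s P :=
    fun Z => subset_boundaryClosure
  set X := boundaryClosure G s P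
  obtain ⟨lev, hlev⟩ : ∃ lev : W → ℕ, ∀ q ∈ Y \ (P ∪ X),
      ∃ v, v ∉ P ∪ X ∧ G.Adj v q ∧ lev v < lev q := by
    refine exists_level fun U hU hne => ?_
    by_contra! hno
    obtain ⟨u₀, hu₀⟩ := hne
    have hU' : ∀ u ∈ U, u ∉ P ∪ X := fun u hu => (Finset.mem_sdiff.1 (hU hu)).2
    refine hU' u₀ hu₀ (Finset.mem_union_right _ (hmax U
      ((Finset.card_le_card (hU.trans Finset.sdiff_subset)).trans hY) (fun v hv => ?_) hu₀))
    obtain ⟨hvU, u, hu, hvu⟩ := mem_outerNbrs.1 hv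
    by_contra hvP
    have hvX : v ∈ X := by
      by_contra hvX
      exact hno u hu v (by simp [hvP, hvX]) hvU hvu
    have huX : u ∉ X := fun h => hU' u hu (Finset.mem_union_right _ h)
    exact hU' u hu (Finset.mem_union_left _ (hXP (mem_outerNbrs.2 ⟨huX, v, hvX, hvu.symm⟩)))
  obtain ⟨g, hginj, hglev, n, hgn⟩ := exists_injective_refinement lev
  refine ⟨g, n, hgn, fun h hh => ⟨fun v w hvw => ?_, fun y hy => ?_⟩⟩
  · have h1 := hgn v
    have h2 := hgn w
    simp only [placeAbove] at hvw
    split_ifs at hvw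
    · exact hh.1 (by omega)
    · omega
    · omega
    · exact hginj hvw
  · by_cases hyX : y ∈ X
    · obtain ⟨v, hvy, hlt⟩ := hh.2 y hyX
      have hv : v ∈ P ∪ X := by
        by_cases hvX : v ∈ X
        · exact Finset.mem_union_right _ hvX
        · exact Finset.mem_union_left _ (hXP (mem_outerNbrs.2 ⟨hvX, y, hyX, hvy⟩))
      refine ⟨v, hvy, ?_⟩
      simpa only [placeAbove, hv, Finset.mem_union_right P hyX, if_true, add_lt_add_iff_right]
    by_cases hyP : y ∈ P
    · obtain ⟨v, hvS, hvy⟩ : ∃ v, v ∉ P ∪ X ∧ G.Adj v y := by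
        by_contra! hno
        refine hyX (hmax (insert y X) ?_ (fun v hv => ?_) (Finset.mem_insert_self y X))
        · have := Finset.card_insert_le y X
          omega
        · obtain ⟨hvX, u, hu, hvu⟩ := mem_outerNbrs.1 hv
          rw [Finset.mem_insert, not_or] at hvX
          rcases Finset.mem_insert.1 hu with rfl | hu
          · by_contra hvP
            exact hno v (by simp [hvP, hvX.2]) hvu
          · exact hXP (mem_outerNbrs.2 ⟨hvX.2, u, hu, hvu⟩)
      refine ⟨v, hvy, ?_⟩
      have := hgn v
      simp only [placeAbove, hvS, Finset.mem_union_left X hyP, if_true, if_false]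
      omega
    · have hyS : y ∉ P ∪ X := by simp [hyP, hyX]
      obtain ⟨v, hvS, hvy, hlt⟩ := hlev y (Finset.mem_sdiff.2 ⟨hy, hyS⟩)
      refine ⟨v, hvy, ?_⟩
      simpa only [placeAbove, hvS, hyS, if_false] using hglev v y hlt

/-- Normal forms of monomials over `P` only mention vertices in `P` and its closure. -/
lemma IsVertexExpander.normalForm_mem_supported (hexp : IsVertexExpander G s δ) {P : Finset W}
    (hs : 2 * (#P : ℝ) < δ * s) {A : Finset (W × W)} (hA : vertices A ⊆ P) :
    normalForm cardRank (vanishing G (boundaryClosure G s P)) (Finsupp.single A 1) ∈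
      Finsupp.supported F2 F2 {B | vertices B ⊆ P ∪ boundaryClosure G s P} := by
  obtain ⟨g, n, hg, h⟩ := hexp.exists_placeAbove hs (hexp.boundaryClosure_spec hs).1
  exact normalForm_mem_supported_vertices hg h (hA.trans Finset.subset_union_left)

/-- Normal forms of monomials over `P` do not change when its closure is enlarged. -/
lemma IsVertexExpander.normalForm_eq (hexp : IsVertexExpander G s δ) {P Y : Finset W}
    (hs : 2 * (#P : ℝ) < δ * s) (hY : #Y ≤ s) (hPY : boundaryClosure G s P ⊆ Y)
    {A : Finset (W × W)} (hA : vertices A ⊆ P) :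
    normalForm cardRank (vanishing G Y) (Finsupp.single A 1) =
      normalForm cardRank (vanishing G (boundaryClosure G s P)) (Finsupp.single A 1) := by
  obtain ⟨g, n, hg, h⟩ := hexp.exists_placeAbove hs hY
  refine normalForm_eq_of cardRank_injective ?_
    (vanishing_mono hPY (sub_normalForm_mem _ _ _))
  rw [Finsupp.mem_supported]
  intro B hB hred
  exact (Finsupp.mem_supported F2 _).1 (normalForm_mem _ _ _) hB
    (hred.of_placeAbove hg h
      ((Finsupp.mem_supported F2 _).1 (hexp.normalForm_mem_supported hs hA) hB))

end Expander

section GraphReduction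

open MvPolynomial

variable {W : Type} [Fintype W] [DecidableEq W] (G : SimpleGraph W) [DecidableRel G.Adj]
  (s : ℕ)

/-- The reduction operator: each monomial is replaced by its normal form modulo the polynomials
vanishing on the orderings good for the closure of the vertices of the monomial. -/
noncomputable def localNormalForm :
    (Finset (W × W) →₀ F2) →ₗ[F2] (Finset (W × W) →₀ F2) :=
  Finsupp.linearCombination F2 fun A =>
    normalForm cardRank (vanishing G (boundaryClosure G s (vertices A))) (Finsupp.single A 1)

/-- Multiplication of multilinear polynomials by a variable. -/
noncomputable def mulVar (v : W × W) :
    (Finset (W × W) →₀ F2) →ₗ[F2] (Finset (W × W) →₀ F2) :=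
  Finsupp.lmapDomain F2 F2 (insert v)

/-- Multilinearization of polynomials. -/
noncomputable def multilinearize (W : Type) :
    MvPolynomial (W × W) F2 →ₗ[F2] (Finset (W × W) →₀ F2) :=
  (basisMonomials (W × W) F2).constr F2 fun m => Finsupp.single m.support 1

lemma localNormalForm_single (A : Finset (W × W)) :
    localNormalForm G s (Finsupp.single A 1) =
      normalForm cardRank (vanishing G (boundaryClosure G s (vertices A)))
        (Finsupp.single A 1) := by
  simp [localNormalForm]

omit [Fintype W] in
lemma mulVar_single (v : W × W) (A : Finset (W × W)) (c : F2) :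
    mulVar v (Finsupp.single A c) = Finsupp.single (insert v A) c := by
  simp [mulVar]

omit [Fintype W] [DecidableEq W] in
lemma multilinearize_monomial (m : W × W →₀ ℕ) (c : F2) :
    multilinearize W (monomial m c) = Finsupp.single m.support c := by
  have h : multilinearize W (monomial m 1) = Finsupp.single m.support 1 := by
    simpa [multilinearize] using (basisMonomials (W × W) F2).constr_basis F2
      (fun m => Finsupp.single m.support (1 : F2)) m
  rw [← mul_one c, ← smul_eq_mul, ← smul_monomial, map_smul, h, Finsupp.smul_single]

omit [Fintype W] in
lemma multilinearize_X_mul (v : W × W) (p : MvPolynomial (W × W) F2) :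
    multilinearize W (X v * p) = mulVar v (multilinearize W p) := by
  induction p using MvPolynomial.induction_on' with
  | monomial m c =>
    rw [X, monomial_mul, one_mul, multilinearize_monomial, multilinearize_monomial,
      mulVar_single]
    congr 1
    ext w
    simp only [Finsupp.mem_support_iff, Finsupp.add_apply, Finsupp.single_apply,
      Finset.mem_insert]
    split_ifs with h <;> simp [h, eq_comm (a := w)]
  | add p q hp hq => rw [mul_add, map_add, map_add, hp, hq, map_add]

omit [Fintype W] [DecidableEq W] in
lemma ordEval_multilinearize (h : W → ℕ) (p : MvPolynomial (W × W) F2) :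
    ordEval h (multilinearize W p) = eval (fun a => if h a.1 < h a.2 then 1 else 0) p := by
  induction p using MvPolynomial.induction_on' with
  | monomial m c =>
    rw [multilinearize_monomial, eval_monomial, ordEval, Finsupp.linearCombination_single,
      smul_eq_mul, monomialValue, Finsupp.prod]
    congr 1
    refine Finset.prod_congr rfl fun a ha => ?_
    rw [ite_pow, one_pow, zero_pow (Finsupp.mem_support_iff.1 ha)]
  | add p q hp hq => rw [map_add, map_add, map_add, hp, hq]

omit [Fintype W] [DecidableEq W] in
lemma multilinearize_mem_supported (p : MvPolynomial (W × W) F2) {P : Finset (W × W) → Prop}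
    (hP : ∀ m ∈ p.support, P m.support) :
    multilinearize W p ∈ Finsupp.supported F2 F2 {A | P A} := by
  rw [p.as_sum, map_sum]
  refine Submodule.sum_mem _ fun m hm => ?_
  rw [multilinearize_monomial]
  exact Finsupp.single_mem_supported F2 _ (hP m hm)

omit [Fintype W] in
lemma mulVar_mulVar (v : W × W) (p : Finset (W × W) →₀ F2) :
    mulVar v (mulVar v p) = mulVar v p := by
  have : (mulVar v).comp (mulVar v) = mulVar v := by
    refine Finsupp.lhom_ext' fun A => LinearMap.ext_ring ?_
    simp [mulVar_single]
  exact LinearMap.congr_fun this p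

omit [Fintype W] in
lemma ordEval_mulVar (h : W → ℕ) (v : W × W) (p : Finset (W × W) →₀ F2) :
    ordEval h (mulVar v p) = (if h v.1 < h v.2 then 1 else 0) * ordEval h p := by
  have : (ordEval h).comp (mulVar v) = (if h v.1 < h v.2 then (1 : F2) else 0) • ordEval h := by
    refine Finsupp.lhom_ext' fun A => LinearMap.ext_ring ?_
    simp only [LinearMap.comp_apply, Finsupp.lsingle_apply, mulVar_single, ordEval,
      Finsupp.linearCombination_single, LinearMap.smul_apply, smul_eq_mul, one_mul]
    by_cases hv : v ∈ A
    · rw [Finset.insert_eq_of_mem hv, monomialValue, ← Finset.mul_prod_erase A _ hv, ← mul_assoc,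
        F2.mul_self]
    · rw [monomialValue, Finset.prod_insert hv, monomialValue]
  exact LinearMap.congr_fun this p

variable {G s} {δ : ℝ}

omit [Fintype W] [DecidableRel G.Adj] in
lemma mulVar_mem_vanishing {X : Finset W} (v : W × W) {p : Finset (W × W) →₀ F2}
    (hp : p ∈ vanishing G X) : mulVar v p ∈ vanishing G X :=
  mem_vanishing.2 fun h hh => by rw [ordEval_mulVar, mem_vanishing.1 hp h hh, mul_zero]

omit [Fintype W] [DecidableEq W] in
lemma linearMap_eq_on_supported {β T : Type*} [AddCommGroup T] [Module F2 T]
    {f g : (β →₀ F2) →ₗ[F2] T} {Q : Set β}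
    (h : ∀ b ∈ Q, f (Finsupp.single b 1) = g (Finsupp.single b 1)) {p : β →₀ F2}
    (hp : p ∈ Finsupp.supported F2 F2 Q) : f p = g p := by
  rw [Finsupp.supported_eq_span_single] at hp
  refine LinearMap.eqOn_span (f := f) (g := g) ?_ hp
  rintro _ ⟨b, hb, rfl⟩
  exact h b hb

namespace IsVertexExpander

lemma localNormalForm_eq_normalForm (hexp : IsVertexExpander G s δ) {P : Finset W}
    (hs : 2 * (#P : ℝ) < δ * s) {p : Finset (W × W) →₀ F2}
    (hp : p ∈ Finsupp.supported F2 F2 {A | vertices A ⊆ P}) :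
    localNormalForm G s p = normalForm cardRank (vanishing G (boundaryClosure G s P)) p := by
  refine linearMap_eq_on_supported (fun A hA => ?_) hp
  have hA' : (#(vertices A) : ℝ) ≤ #P := by exact_mod_cast Finset.card_le_card hA
  rw [localNormalForm_single]
  exact (hexp.normalForm_eq (by linarith) (hexp.boundaryClosure_spec hs).1
    (boundaryClosure_mono hA) subset_rfl).symm

lemma localNormalForm_mulVar_single (hexp : IsVertexExpander G s δ) {D : ℕ}
    (hD : 4 * (D : ℝ) < δ * s) (v : W × W) {A : Finset (W × W)} (hA : #A < D) :
    localNormalForm G s (mulVar v (Finsupp.single A 1)) =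
      localNormalForm G s (mulVar v (localNormalForm G s (Finsupp.single A 1))) := by
  have hsmall : ∀ B : Finset (W × W), #B ≤ D → 2 * (#(vertices B) : ℝ) < δ * s := by
    intro B hB
    have : (#(vertices B) : ℝ) ≤ 2 * D := by
      exact_mod_cast (card_vertices_le B).trans (Nat.mul_le_mul_left 2 hB)
    linarith
  have hcardB : ∀ B : Finset (W × W), #B ≤ #A → #(insert v B) ≤ D := fun B hB =>
    (Finset.card_insert_le v B).trans (by omega)
  have hZs := hexp.two_mul_card_boundaryClosure_lt (hsmall _ (hcardB A le_rfl))
  obtain ⟨hZ1, hZ2⟩ := hexp.boundaryClosure_spec (hsmall _ (hcardB A le_rfl))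
  have hAZ : boundaryClosure G s (vertices A) ⊆
      boundaryClosure G s (vertices (insert v A)) :=
    boundaryClosure_mono (vertices_mono (Finset.subset_insert v A))
  have hZmax : ∀ Z : Finset W, #Z ≤ s → outerNbrs G Z ⊆ vertices (insert v A) →
      Z ⊆ boundaryClosure G s (vertices (insert v A)) := fun Z => subset_boundaryClosure
  have hq := hexp.normalForm_mem_supported (hsmall A hA.le) subset_rfl
  have hqr := normalForm_single_mem cardRank
    (vanishing G (boundaryClosure G s (vertices A))) A
  have hqI := sub_normalForm_mem cardRank
    (vanishing G (boundaryClosure G s (vertices A))) (Finsupp.single A 1)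
  rw [← localNormalForm_single] at hq hqr hqI
  set q := localNormalForm G s (Finsupp.single A 1)
  rw [mulVar_single, localNormalForm_single, ← mulVar_single]
  set Z := boundaryClosure G s (vertices (insert v A))
  have hB : localNormalForm G s (mulVar v q) =
      normalForm cardRank (vanishing G Z) (mulVar v q) := by
    refine linearMap_eq_on_supported (f := (localNormalForm G s).comp (mulVar v))
      (g := (normalForm cardRank (vanishing G Z)).comp (mulVar v))
      (Q := {B | vertices B ⊆ vertices A ∪ boundaryClosure G s (vertices A) ∧ #B ≤ #A})
      ?_ ?_
    · rintro B ⟨hBA, hBcard⟩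
      have hBs := hsmall _ (hcardB B hBcard)
      have hXs := hexp.two_mul_card_boundaryClosure_lt hBs
      obtain ⟨hX1, hX2⟩ := hexp.boundaryClosure_spec hBs
      simp only [LinearMap.comp_apply, mulVar_single, localNormalForm_single]
      refine (hexp.normalForm_eq hBs hZ1 (subset_trans Finset.subset_union_left
        (hZmax (boundaryClosure G s (vertices (insert v B)) ∪ Z) ?_ ?_)) subset_rfl).symm
      · refine (Finset.card_union_le _ _).trans ?_
        omega
      · intro w hw
        rcases Finset.mem_union.1 (outerNbrs_union_subset G _ _ hw) with hwX | hwZ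
        · have hwZ : w ∉ Z := fun h => (mem_outerNbrs.1 hw).1 (Finset.mem_union_right _ h)
          have hsub : vertices (insert v B) ⊆ vertices (insert v A) ∪ Z := by
            rw [vertices_subset_iff] at hBA ⊢
            have hA' : vertices A ⊆ vertices (insert v A) :=
              vertices_mono (Finset.subset_insert v A)
            have hv := vertices_subset_iff.1 (subset_refl (vertices (insert v A))) v
              (Finset.mem_insert_self v A)
            intro p hp
            rcases Finset.mem_insert.1 hp with rfl | hp
            · exact ⟨Finset.mem_union_left _ hv.1, Finset.mem_union_left _ hv.2⟩
            · exact ⟨Finset.union_subset_union hA' hAZ (hBA p hp).1,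
                Finset.union_subset_union hA' hAZ (hBA p hp).2⟩
          exact (Finset.mem_union.1 (hsub (hX2 hwX))).resolve_right hwZ
        · exact hZ2 hwZ
    · rw [Finsupp.mem_supported] at hq hqr ⊢
      exact fun B hBq => ⟨hq hBq, card_le_of_cardRank_le (hqr hBq).2⟩
  rw [hB, ← sub_eq_zero, ← map_sub, ← map_sub, normalForm_eq_zero_iff cardRank_injective]
  exact mulVar_mem_vanishing v (vanishing_mono hAZ hqI)

lemma isDegreeReduction (hexp : IsVertexExpander G s δ) {D : ℕ}
    (hD : 4 * (D : ℝ) < δ * s) :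
    IsDegreeReduction ((localNormalForm G s).comp (multilinearize W)) D where
  one_ne_zero h := by
    have hδs : 0 < δ * s := lt_of_le_of_lt (by positivity) hD
    have hs : 2 * (#(vertices (∅ : Finset (W × W))) : ℝ) < δ * s := by simpa [vertices]
    have hclosure : boundaryClosure G s (vertices (∅ : Finset (W × W))) = ∅ := by
      have h1 := hexp _ (hexp.boundaryClosure_spec hs).1
      have h2 := (hexp.boundaryClosure_spec hs).2
      have h3 : outerNbrs G (boundaryClosure G s (vertices (∅ : Finset (W × W)))) = ∅ :=
        Finset.subset_empty.1 (h2.trans (by simp [vertices]))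
      rw [outerNbrs] at h3
      rw [h3, Finset.card_empty, Nat.cast_zero] at h1
      have hδ : 0 < δ := pos_of_mul_pos_left hδs (Nat.cast_nonneg s)
      have h4 := nonpos_of_mul_nonpos_right h1 hδ
      exact Finset.card_eq_zero.1 (by exact_mod_cast le_antisymm h4 (Nat.cast_nonneg _))
    have h1 : multilinearize W 1 = Finsupp.single ∅ 1 := by
      simpa using multilinearize_monomial (W := W) 0 1
    rw [LinearMap.comp_apply, h1, localNormalForm_single,
      normalForm_eq_zero_iff cardRank_injective, hclosure, mem_vanishing] at h
    have h2 := h (fun w => Fintype.equivFin W w)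
      ⟨fun v w hvw => (Fintype.equivFin W).injective (Fin.ext hvw), by simp⟩
    simp [ordEval, monomialValue] at h2
  boolean v p := by
    simp only [LinearMap.comp_apply, multilinearize_X_mul, mulVar_mulVar]
  mul_eq_zero v p hp h := by
    rw [LinearMap.comp_apply] at h ⊢
    rw [multilinearize_X_mul]
    have hsupp : multilinearize W p ∈ Finsupp.supported F2 F2 {A | #A < D} := by
      refine multilinearize_mem_supported p fun m hm => lt_of_le_of_lt ?_ hp
      refine le_trans ?_ (le_totalDegree hm)
      rw [Finset.card_eq_sum_ones]
      exact Finset.sum_le_sum fun a ha =>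
        Nat.one_le_iff_ne_zero.2 (Finsupp.mem_support_iff.1 ha)
    have := linearMap_eq_on_supported (f := (localNormalForm G s).comp (mulVar v))
      (g := ((localNormalForm G s).comp (mulVar v)).comp (localNormalForm G s))
      (fun A hA => hexp.localNormalForm_mulVar_single hD v hA) hsupp
    simpa only [LinearMap.comp_apply, h, map_zero] using this

/-- The reduction kills the falsity of a clause over few vertices that holds in all orderings
good for the closure of these vertices. -/
lemma localNormalForm_falsity (hexp : IsVertexExpander G s δ) {P : Finset W}
    (hs : 2 * (#P : ℝ) < δ * s) {C : LinClause (W × W)}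
    (hvars : ∀ c ∈ C, ∀ a : W × W, c.1 a ≠ 0 → a.1 ∈ P ∧ a.2 ∈ P)
    (hsat : ∀ h ∈ goodOrders G (boundaryClosure G s P),
      ClauseSat (fun a : W × W => if h a.1 < h a.2 then 1 else 0) C) :
    (localNormalForm G s).comp (multilinearize W) (∏ c ∈ C, litPoly (litNot c)) = 0 := by
  have hmem : ∏ c ∈ C, litPoly (litNot c) ∈
      MvPolynomial.supported F2 {a : W × W | a.1 ∈ P ∧ a.2 ∈ P} := by
    refine Subalgebra.prod_mem _ fun c hc => ?_
    refine Subalgebra.add_mem _ (Subalgebra.sum_mem _ fun a _ => ?_)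
      (Subalgebra.algebraMap_mem _ (c.2 + 1 + 1))
    by_cases ha : c.1 a = 0
    · simp [litNot, ha]
    · exact Subalgebra.mul_mem _ (Subalgebra.algebraMap_mem _ (c.1 a))
        ((X_mem_supported (R := F2)).2 (hvars c hc a ha))
  rw [LinearMap.comp_apply, hexp.localNormalForm_eq_normalForm hs,
    normalForm_eq_zero_iff cardRank_injective, mem_vanishing]
  · intro h hh
    obtain ⟨c, hc, hsatc⟩ := hsat h hh
    rw [ordEval_multilinearize, map_prod]
    refine Finset.prod_eq_zero hc ?_
    rw [litPoly_litNot, map_add, map_one, (litSat_iff_eval_litPoly _ _).1 hsatc]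
    exact CharTwo.add_self_eq_zero 1
  · refine multilinearize_mem_supported _ fun m hm => vertices_subset_iff.2 fun a ha => ?_
    exact mem_supported.1 hmem ((mem_vars_iff_mem_support a).2 ⟨m, hm, ha⟩)

end IsVertexExpander

end GraphReduction

section GraphOrdering

lemma evalForm_single [Fintype V] [DecidableEq V] (σ : V → F2) (v : V) :
    evalForm (Pi.single v 1) σ = σ v := by
  simp [evalForm, Pi.single_apply]

lemma litSat_posLit [Fintype V] [DecidableEq V] {σ : V → F2} {v : V} :
    LitSat σ (posLit v) ↔ σ v = 1 := by
  simp [LitSat, posLit, evalForm_single]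

lemma litSat_negLit [Fintype V] [DecidableEq V] {σ : V → F2} {v : V} :
    LitSat σ (negLit v) ↔ σ v = 0 := by
  simp [LitSat, negLit, evalForm_single]

lemma eq_of_posLit_ne_zero [DecidableEq V] {v w : V} (h : (posLit v).1 w ≠ 0) : w = v := by
  by_contra hne
  exact h (Pi.single_eq_of_ne hne _)

lemma eq_of_negLit_ne_zero [DecidableEq V] {v w : V} (h : (negLit v).1 w ≠ 0) : w = v :=
  eq_of_posLit_ne_zero h

variable {W : Type} [Fintype W] [DecidableEq W] {G : SimpleGraph W} [DecidableRel G.Adj]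

lemma card_le_of_mem_GOPCNF {d : ℕ} (hd : 3 ≤ d) (hreg : ∀ v : W, #(G.neighborFinset v) = d)
    {C : LinClause (W × W)} (hC : C ∈ GOPCNF G) : #C ≤ d := by
  rcases hC with ((⟨u, v, -, rfl⟩ | ⟨u, v, -, rfl⟩) | ⟨u, v, w, -, -, -, rfl⟩) | ⟨u, rfl⟩
  · exact Finset.card_le_two.trans (by omega)
  · exact Finset.card_le_two.trans (by omega)
  · exact Finset.card_le_three.trans hd
  · exact Finset.card_image_le.trans (hreg u).le

lemma IsVertexExpander.localNormalForm_GOPCNF {s d : ℕ} {δ : ℝ} (hexp : IsVertexExpander G s δ)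
    (hs : 4 * (d : ℝ) < δ * s) (hd : 3 ≤ d) (hreg : ∀ v : W, #(G.neighborFinset v) = d)
    {C : LinClause (W × W)} (hC : C ∈ GOPCNF G) :
    (localNormalForm G s).comp (multilinearize W) (∏ c ∈ C, litPoly (litNot c)) = 0 := by
  have hsmall : ∀ P : Finset W, #P ≤ d + 1 → 2 * (#P : ℝ) < δ * s := by
    intro P hP
    have h1 : (#P : ℝ) ≤ d + 1 := by exact_mod_cast hP
    have h2 : (3 : ℝ) ≤ d := by exact_mod_cast hd
    linarith
  rcases hC with ((⟨u, v, huv, rfl⟩ | ⟨u, v, huv, rfl⟩) | ⟨u, v, w, -, -, -, rfl⟩) | ⟨u, rfl⟩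
  · refine hexp.localNormalForm_falsity (P := {u, v})
      (hsmall _ (Finset.card_le_two.trans (by omega))) ?_ ?_
    · simp only [Finset.mem_insert, Finset.mem_singleton]
      rintro c (rfl | rfl) a ha <;> simp [eq_of_negLit_ne_zero ha]
    · intro h _
      by_cases huv : h u < h v
      · exact ⟨negLit (v, u), by simp, litSat_negLit.2 (by simp [huv.le])⟩
      · exact ⟨negLit (u, v), by simp, litSat_negLit.2 (by simpa using huv)⟩
  · refine hexp.localNormalForm_falsity (P := {u, v})
      (hsmall _ (Finset.card_le_two.trans (by omega))) ?_ ?_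
    · simp only [Finset.mem_insert, Finset.mem_singleton]
      rintro c (rfl | rfl) a ha <;> simp [eq_of_posLit_ne_zero ha]
    · intro h hh
      rcases (hh.1.ne huv).lt_or_gt with hlt | hlt
      · exact ⟨posLit (u, v), by simp, litSat_posLit.2 (by simp [hlt])⟩
      · exact ⟨posLit (v, u), by simp, litSat_posLit.2 (by simp [hlt])⟩
  · refine hexp.localNormalForm_falsity (P := {u, v, w})
      (hsmall _ (Finset.card_le_three.trans (by omega))) ?_ ?_
    · simp only [Finset.mem_insert, Finset.mem_singleton]
      rintro c (rfl | rfl | rfl) a ha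
      · simp [eq_of_negLit_ne_zero ha]
      · simp [eq_of_negLit_ne_zero ha]
      · simp [eq_of_posLit_ne_zero ha]
    · intro h _
      by_cases huv : h u < h v
      · by_cases hvw : h v < h w
        · exact ⟨posLit (u, w), by simp, litSat_posLit.2 (by simp [huv.trans hvw])⟩
        · exact ⟨negLit (v, w), by simp, litSat_negLit.2 (by simpa using hvw)⟩
      · exact ⟨negLit (u, v), by simp, litSat_negLit.2 (by simpa using huv)⟩
  · refine hexp.localNormalForm_falsity (P := insert u (G.neighborFinset u))
      (hsmall _ ((Finset.card_insert_le _ _).trans (by rw [hreg]))) ?_ ?_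
    · intro c hc a ha
      obtain ⟨v, hv, rfl⟩ := Finset.mem_image.1 hc
      rw [eq_of_posLit_ne_zero ha]
      exact ⟨Finset.mem_insert_of_mem hv, Finset.mem_insert_self _ _⟩
    · intro h hh
      have hs0 : s ≠ 0 := by
        rintro rfl
        rw [Nat.cast_zero, mul_zero] at hs
        exact hs.not_ge (by positivity)
      have hsub : outerNbrs G {u} ⊆ insert u (G.neighborFinset u) := by
        intro v hv
        obtain ⟨-, w, hw, hvw⟩ := mem_outerNbrs.1 hv
        rw [Finset.mem_singleton.1 hw] at hvw
        exact Finset.mem_insert_of_mem ((G.mem_neighborFinset u v).2 hvw.symm)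
      obtain ⟨v, hvu, hlt⟩ := hh.2 u (subset_boundaryClosure
        (by rw [Finset.card_singleton]; omega) hsub (Finset.mem_singleton_self u))
      exact ⟨posLit (v, u), Finset.mem_image_of_mem _ ((G.mem_neighborFinset u v).2 hvu.symm),
        litSat_posLit.2 (by simp [hlt])⟩

end GraphOrdering

/-- For a non-bipartite `d`-regular graph `G` with `d ≥ 3` that is an
`(s, δ)`-vertex expander, every configuration-style Res(⊕) refutation of `GOP(G)` has
space at least `δs/4 − d`. -/
theorem gop_space_lower_bound {W : Type} [Fintype W] [DecidableEq W]
    (G : SimpleGraph W) [DecidableRel G.Adj] (d s : ℕ) (δ : ℝ)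
    (hd : 3 ≤ d) (hreg : ∀ v : W, (G.neighborFinset v).card = d)
    (hnonbip : ¬ G.Colorable 2) (hexp : IsVertexExpander G s δ)
    (π : List (Config (W × W))) (hπ : IsConfigRefutation (GOPCNF G) InferSem π) :
    δ * s / 4 - d ≤ (spaceOf π : ℝ) := by
  by_contra! hlt
  have hD : 4 * ((spaceOf π + d : ℕ) : ℝ) < δ * s := by
    push_cast
    linarith
  refine lt_irrefl _ (lt_spaceOf_add_of_isDegreeReduction (hexp.isDegreeReduction hD)
    (fun C => card_le_of_mem_GOPCNF hd hreg)
    (fun C => hexp.localNormalForm_GOPCNF (lt_of_le_of_lt ?_ hD) hd hreg) hπ)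
  push_cast
  linarith [Nat.cast_nonneg (α := ℝ) (spaceOf π)]
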